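/- arXiv:1302.3308 — 2 statements merged into one kernel-verified Lean document; each statement's English description precedes it below -/
import Mathlib

section
/- Let F be a field of characteristic zero and let l_1,…,l_r be homogeneous linear forms in F[Y ∪ Z]. Suppose P = Σ_{i=1}^t c_i Π_{u=1}^d l_{α(i,u)}, where each c_i ∈ F and each α(i,u) ∈ [r] (so P is a linear combination of products of exactly d forms from the list, repetitions allowed). Then maxrank(M_P) ≤ (d+1) · C(d+r, r). -/
open scoped Classical

noncomputable section

namespace PCM

variable {F : Type} [Field F] {Y Z : Type} [Fintype Y] [Fintype Z]

/-- Exponent vector of the monic multilinear monomial `∏_{y ∈ p} y · ∏_{z ∈ q} z`. -/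
def mexp (p : Finset Y) (q : Finset Z) : (Y ⊕ Z) →₀ ℕ :=
  (∑ y ∈ p, Finsupp.single (Sum.inl y) 1) + ∑ z ∈ q, Finsupp.single (Sum.inr z) 1

/-- The polynomial coefficient matrix `M_f`. -/
def coeffMatrix (f : MvPolynomial (Y ⊕ Z) F) :
    Matrix (Finset Y) (Finset Z) (MvPolynomial (Y ⊕ Z) F) := fun p q =>
  ∑ d ∈ f.support,
    if d.support ⊆ p.image Sum.inl ∪ q.image Sum.inr ∧ mexp p q ≤ d then
      MvPolynomial.monomial (d - mexp p q) (MvPolynomial.coeff d f)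
    else 0

/-- `maxrank(M_f)`: the maximum, over substitutions `S`, of the rank of `M_f|_S`. -/
def maxrank (f : MvPolynomial (Y ⊕ Z) F) : ℕ :=
  ⨆ S : (Y ⊕ Z) → F, ((coeffMatrix f).map (MvPolynomial.eval S)).rank

/-- The partial derivatives matrix `L_f`. -/
def pdMatrix (f : MvPolynomial (Y ⊕ Z) F) : Matrix (Finset Y) (Finset Z) F := fun p q =>
  MvPolynomial.coeff (mexp p q) f

end PCM

namespace PCM

section supportEval

variable {F : Type} [Field F] {σ : Type} [Fintype σ]

/-- The weight of the exponent vector `e` with respect to the set of variables `T`: it is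
`∏ x ∈ T, S x ^ (e x - 1)` if the support of `e` is `T`, and `0` otherwise. -/
def weight (S : σ → F) (T : Finset σ) (e : σ →₀ ℕ) : F :=
  ∏ x, if x ∈ T then (if e x = 0 then 0 else S x ^ (e x - 1)) else if e x = 0 then 1 else 0

/-- The linear functional summing the terms of a polynomial whose set of variables is exactly `T`,
each divided by `∏ x ∈ T, x` and evaluated at `S`. -/
def supportEval (S : σ → F) (T : Finset σ) : MvPolynomial σ F →ₗ[F] F :=
  (MvPolynomial.basisMonomials σ F).constr F (weight S T)

lemma supportEval_monomial (S : σ → F) (T : Finset σ) (e : σ →₀ ℕ) (a : F) :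
    supportEval S T (MvPolynomial.monomial e a) = a * weight S T e := by
  have h : MvPolynomial.monomial e a = a • MvPolynomial.basisMonomials σ F e := by
    simp [MvPolynomial.smul_monomial]
  rw [h, map_smul, supportEval, Module.Basis.constr_basis, smul_eq_mul]

lemma weight_of_support_eq (S : σ → F) {T : Finset σ} {e : σ →₀ ℕ} (h : e.support = T) :
    weight S T e = ∏ x, S x ^ (e x - if x ∈ T then 1 else 0) := by
  subst h
  refine Finset.prod_congr rfl fun x _ => ?_
  by_cases hx : e x = 0 <;> simp [hx]

lemma weight_of_support_ne (S : σ → F) {T : Finset σ} {e : σ →₀ ℕ} (h : e.support ≠ T) :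
    weight S T e = 0 := by
  obtain ⟨x, hx⟩ : ∃ x, ¬(x ∈ e.support ↔ x ∈ T) := by
    by_contra! h'
    exact h (Finset.ext h')
  refine Finset.prod_eq_zero (Finset.mem_univ x) ?_
  by_cases h0 : e x = 0 <;> by_cases hT : x ∈ T <;> simp_all

end supportEval

variable {F : Type} [Field F] {Y Z : Type}

lemma mexp_apply (p : Finset Y) (q : Finset Z) (x : Y ⊕ Z) :
    mexp p q x = if x ∈ p.disjSum q then 1 else 0 := by
  rcases x with y | z <;> simp [mexp, Finsupp.single_apply]

lemma support_subset_and_mexp_le_iff (p : Finset Y) (q : Finset Z) (e : (Y ⊕ Z) →₀ ℕ) :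
    (e.support ⊆ p.image Sum.inl ∪ q.image Sum.inr ∧ mexp p q ≤ e) ↔
      e.support = p.disjSum q := by
  have himage : p.image Sum.inl ∪ q.image Sum.inr = p.disjSum q := by
    ext x
    rcases x with y | z <;> simp
  have hle : mexp p q ≤ e ↔ p.disjSum q ⊆ e.support := by
    simp only [Finsupp.le_def, mexp_apply, Finset.subset_iff, Finsupp.mem_support_iff]
    refine forall_congr' fun x => ?_
    split_ifs with h <;> simp [h, Nat.one_le_iff_ne_zero]
  rw [himage, hle, Finset.Subset.antisymm_iff]

lemma exists_rename_add_rename {f : MvPolynomial (Y ⊕ Z) F} (hf : f.IsHomogeneous 1) :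
    ∃ (g : MvPolynomial Y F) (h : MvPolynomial Z F),
      f = MvPolynomial.rename Sum.inl g + MvPolynomial.rename Sum.inr h := by
  rw [← MvPolynomial.mem_homogeneousSubmodule,
    MvPolynomial.homogeneousSubmodule_one_eq_span_X] at hf
  induction hf using Submodule.span_induction with
  | mem f hf =>
    obtain ⟨y | z, rfl⟩ := hf
    · exact ⟨MvPolynomial.X y, 0, by simp⟩
    · exact ⟨0, MvPolynomial.X z, by simp⟩
  | zero => exact ⟨0, 0, by simp⟩
  | add f₁ f₂ _ _ ih₁ ih₂ =>
    obtain ⟨g₁, h₁, rfl⟩ := ih₁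
    obtain ⟨g₂, h₂, rfl⟩ := ih₂
    exact ⟨g₁ + g₂, h₁ + h₂, by simp only [map_add]; ring⟩
  | smul a f _ ih =>
    obtain ⟨g, h, rfl⟩ := ih
    exact ⟨a • g, a • h, by simp only [map_smul, smul_add]⟩

variable [Fintype Y] [Fintype Z]

lemma eval_coeffMatrix (S : Y ⊕ Z → F) (f : MvPolynomial (Y ⊕ Z) F) (p : Finset Y)
    (q : Finset Z) :
    MvPolynomial.eval S (coeffMatrix f p q) = supportEval S (p.disjSum q) f := by
  conv_rhs => rw [f.as_sum, map_sum]
  rw [coeffMatrix, map_sum]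
  refine Finset.sum_congr rfl fun e _ => ?_
  rw [supportEval_monomial]
  simp only [support_subset_and_mexp_le_iff]
  split_ifs with h
  · rw [weight_of_support_eq S h, MvPolynomial.eval_monomial,
      Finsupp.prod_fintype _ _ fun _ => pow_zero _]
    simp [mexp_apply]
  · rw [weight_of_support_ne S h, map_zero, mul_zero]

lemma weight_mapDomain_add_mapDomain (S : Y ⊕ Z → F) (p : Finset Y) (q : Finset Z)
    (a : Y →₀ ℕ) (b : Z →₀ ℕ) :
    weight S (p.disjSum q) (a.mapDomain Sum.inl + b.mapDomain Sum.inr) =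
      weight (S ∘ Sum.inl) p a * weight (S ∘ Sum.inr) q b := by
  have hl (y : Y) : (b.mapDomain Sum.inr : (Y ⊕ Z) →₀ ℕ) (Sum.inl y) = 0 :=
    Finsupp.mapDomain_of_notMem_range _ _ (by simp)
  have hr (z : Z) : (a.mapDomain Sum.inl : (Y ⊕ Z) →₀ ℕ) (Sum.inr z) = 0 :=
    Finsupp.mapDomain_of_notMem_range _ _ (by simp)
  simp [weight, Fintype.prod_sum_type, hl, hr, Finsupp.mapDomain_apply Sum.inl_injective,
    Finsupp.mapDomain_apply Sum.inr_injective]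

lemma supportEval_rename_mul_rename (S : Y ⊕ Z → F) (p : Finset Y) (q : Finset Z)
    (g : MvPolynomial Y F) (h : MvPolynomial Z F) :
    supportEval S (p.disjSum q) (MvPolynomial.rename Sum.inl g * MvPolynomial.rename Sum.inr h) =
      supportEval (S ∘ Sum.inl) p g * supportEval (S ∘ Sum.inr) q h := by
  conv_lhs => rw [g.as_sum, h.as_sum]
  conv_rhs => rw [g.as_sum, h.as_sum]
  simp only [map_sum, Finset.sum_mul_sum, MvPolynomial.rename_monomial, MvPolynomial.monomial_mul,
    supportEval_monomial, weight_mapDomain_add_mapDomain]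
  refine Finset.sum_congr rfl fun a _ => Finset.sum_congr rfl fun b _ => ?_
  ring

lemma rank_eval_coeffMatrix_sum_prod_le {ι : Type} [Fintype ι] (S : Y ⊕ Z → F) {r d : ℕ}
    (l : Fin r → MvPolynomial (Y ⊕ Z) F) (hl : ∀ i, (l i).IsHomogeneous 1)
    (c : ι → F) (α : ι → Fin d → Fin r) :
    ((coeffMatrix (∑ i, c i • ∏ u, l (α i u))).map (MvPolynomial.eval S)).rank ≤
      (d + r).choose r := by
  choose g h hgh using fun i => exists_rename_add_rename (hl i)
  let v : Sym (Option (Fin r)) d → Finset Y → F := fun s p =>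
    supportEval (S ∘ Sum.inl) p ((s : Multiset (Option (Fin r))).map (Option.elim · 1 g)).prod
  have hcard : Fintype.card (Sym (Option (Fin r)) d) = (d + r).choose r := by
    rw [Sym.card_sym_eq_choose, Fintype.card_option, Fintype.card_fin,
      show r + 1 + d - 1 = d + r by omega, Nat.choose_symm_add]
  rw [← hcard, Matrix.rank_eq_finrank_span_cols]
  refine (Submodule.finrank_mono (Submodule.span_le.2 ?_)).trans (finrank_range_le_card v)
  rintro _ ⟨q, rfl⟩
  have hcol : ((coeffMatrix (∑ i, c i • ∏ u, l (α i u))).map (MvPolynomial.eval S)).col q =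
      ∑ i, ∑ s : Finset (Fin d),
        (c i * supportEval (S ∘ Sum.inr) q (∏ u ∈ Finset.univ \ s, h (α i u))) •
          v ⟨Finset.univ.val.map fun u => if u ∈ s then some (α i u) else none, by simp⟩ := by
    ext p
    have hv (i : ι) (s : Finset (Fin d)) :
        v ⟨Finset.univ.val.map fun u => if u ∈ s then some (α i u) else none, by simp⟩ p =
          supportEval (S ∘ Sum.inl) p (∏ u ∈ s, g (α i u)) := by
      have hprod : ∏ u ∈ s, g (α i u) =
          ∏ u, Option.elim (if u ∈ s then some (α i u) else none) 1 g := by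
        rw [← Finset.prod_subset (Finset.subset_univ s) fun u _ hu => by simp [hu]]
        exact Finset.prod_congr rfl fun u hu => by simp [hu]
      rw [hprod]
      simp only [v, Sym.coe_mk, Multiset.map_map]
      rfl
    simp only [Matrix.col_apply, Matrix.map_apply, eval_coeffMatrix, map_sum, map_smul,
      Finset.sum_apply, Pi.smul_apply, smul_eq_mul, hv]
    refine Finset.sum_congr rfl fun i _ => ?_
    simp only [hgh, Finset.prod_add, Finset.powerset_univ, map_sum, Finset.mul_sum, ← map_prod,
      supportEval_rename_mul_rename]
    refine Finset.sum_congr rfl fun s _ => ?_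
    ring
  rw [hcol]
  exact Submodule.sum_mem _ fun i _ => Submodule.sum_mem _ fun s _ =>
    Submodule.smul_mem _ _ (Submodule.subset_span ⟨_, rfl⟩)

end PCM

/-- over a field of characteristic zero, if `P` is a linear combination
of products of exactly `d` homogeneous linear forms taken from `l_1, …, l_r`, then
`maxrank(M_P) ≤ (d+1) · C(d+r, r)`. -/
theorem maxrank_sps_le {F : Type} [Field F] [CharZero F] {Y Z : Type}
    [Fintype Y] [Fintype Z] (r t d : ℕ)
    (l : Fin r → MvPolynomial (Y ⊕ Z) F) (hl : ∀ i, (l i).IsHomogeneous 1)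
    (c : Fin t → F) (α : Fin t → Fin d → Fin r) (P : MvPolynomial (Y ⊕ Z) F)
    (hP : P = ∑ i : Fin t, c i • ∏ u : Fin d, l (α i u)) :
    PCM.maxrank P ≤ (d + 1) * (d + r).choose r := by
  subst hP
  refine ciSup_le fun S => (PCM.rank_eval_coeffMatrix_sum_prod_le S l hl c α).trans ?_
  exact Nat.le_mul_of_pos_left _ d.succ_pos
end
end

section
/- Let F be a field of characteristic zero and let n be a positive integer divisible by 20. Suppose the polynomial Q is written as Q = Σ_{j=1}^k Π_{i=1}^{s_j} L_{i,j}, where each L_{i,j} is a polynomial of total degree at most 1 (an affine form) and, for each j, the F-linear span of the set {L_{i,j} : i ∈ [s_j]} inside the space of polynomials of degree at most 1 has dimension at most n/10 (product dimension at most n/10). Then k · (n/2 + 1) · C(n/2 + n/10, n/10) ≥ C(n/2, n/4). -/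
open scoped Classical

noncomputable section

namespace QPoly

/-- The explicit polynomial `Q = Σ_i (Π_{y ∈ S_i} y)(Π_{z ∈ T_i} z)`, where the
enumerations of the size-`n/4` subsets of `Y` and `Z` are paired up by `π`. -/
noncomputable def Q (F : Type) [Field F] (n : ℕ)
    (π : Finset (Fin (n / 2)) → Finset (Fin (n / 2))) :
    MvPolynomial (Fin (n / 2) ⊕ Fin (n / 2)) F :=
  ∑ s ∈ Finset.univ.filter (fun s : Finset (Fin (n / 2)) => s.card = n / 4),
    (∏ y ∈ s, MvPolynomial.X (Sum.inl y)) * ∏ z ∈ π s, MvPolynomial.X (Sum.inr z)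

/-- `π` pairs up the size-`n/4` subsets bijectively. -/
def GoodPairing (n : ℕ) (π : Finset (Fin (n / 2)) → Finset (Fin (n / 2))) : Prop :=
  Set.BijOn π {s | s.card = n / 4} {s | s.card = n / 4}

end QPoly

namespace PCM

open MvPolynomial

section CoeffFactorization

variable {R σ τ : Type*} [CommSemiring R]

theorem coeff_rename_inl_mul_rename_inr (A : MvPolynomial σ R) (B : MvPolynomial τ R)
    (a : σ →₀ ℕ) (b : τ →₀ ℕ) :
    coeff (a.mapDomain Sum.inl + b.mapDomain Sum.inr)
      (rename Sum.inl A * rename Sum.inr B) = coeff a A * coeff b B := by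
  have key (u : σ →₀ ℕ) (v : τ →₀ ℕ) :
      u.mapDomain Sum.inl + v.mapDomain Sum.inr = a.mapDomain Sum.inl + b.mapDomain Sum.inr ↔
        u = a ∧ v = b := by
    refine ⟨fun h => ⟨?_, ?_⟩, fun h => by rw [h.1, h.2]⟩
    · ext x
      have := DFunLike.congr_fun h (Sum.inl x)
      simpa [Finsupp.mapDomain_apply Sum.inl_injective,
        Finsupp.mapDomain_of_notMem_range] using this
    · ext x
      have := DFunLike.congr_fun h (Sum.inr x)
      simpa [Finsupp.mapDomain_apply Sum.inr_injective,
        Finsupp.mapDomain_of_notMem_range] using this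
  induction A using MvPolynomial.induction_on' with
  | add p q hp hq => simp only [map_add, add_mul, coeff_add, hp, hq]
  | monomial u c =>
    induction B using MvPolynomial.induction_on' with
    | add p q hp hq => simp only [map_add, mul_add, coeff_add, hp, hq]
    | monomial v e =>
      simp only [rename_monomial, monomial_mul, coeff_monomial, key]
      by_cases hu : u = a <;> by_cases hv : v = b <;> simp [hu, hv]

end CoeffFactorization

theorem rank_add_le {m n K : Type*} [Fintype n] [Finite m] [Field K] (A B : Matrix m n K) :
    (A + B).rank ≤ A.rank + B.rank := by
  have hle : LinearMap.range (A + B).mulVecLin ≤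
      LinearMap.range A.mulVecLin ⊔ LinearMap.range B.mulVecLin := by
    rw [Matrix.mulVecLin_add]
    exact LinearMap.range_add_le _ _
  exact (Submodule.finrank_mono hle).trans
    (Submodule.finrank_add_le_finrank_add_finrank _ _)

theorem rank_sum_le {ι m n K : Type*} [Fintype n] [Finite m] [Field K] (t : Finset ι)
    (A : ι → Matrix m n K) : (∑ i ∈ t, A i).rank ≤ ∑ i ∈ t, (A i).rank := by
  induction t using Finset.induction_on with
  | empty => simp
  | insert i t hi ih =>
    rw [Finset.sum_insert hi, Finset.sum_insert hi]
    exact (rank_add_le _ _).trans (Nat.add_le_add_left ih _)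

variable {F : Type} [Field F] {Y Z : Type}

theorem pdMatrix_sum {ι : Type*} (t : Finset ι) (f : ι → MvPolynomial (Y ⊕ Z) F) :
    pdMatrix (∑ i ∈ t, f i) = ∑ i ∈ t, pdMatrix (f i) := by
  ext p q
  simp [pdMatrix, coeff_sum, Matrix.sum_apply]

theorem mexp_eq_mapDomain (p : Finset Y) (q : Finset Z) :
    mexp p q = (∑ y ∈ p, Finsupp.single y 1).mapDomain Sum.inl +
      (∑ z ∈ q, Finsupp.single z 1).mapDomain Sum.inr := by
  simp [mexp, Finsupp.mapDomain_finsetSum, Finsupp.mapDomain_single]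

theorem mexp_apply_inl (p : Finset Y) (q : Finset Z) (y : Y) :
    mexp p q (Sum.inl y) = if y ∈ p then 1 else 0 := by
  simp [mexp, Finsupp.single_apply]

theorem mexp_apply_inr (p : Finset Y) (q : Finset Z) (z : Z) :
    mexp p q (Sum.inr z) = if z ∈ q then 1 else 0 := by
  simp [mexp, Finsupp.single_apply]

theorem mexp_inj {p p' : Finset Y} {q q' : Finset Z} :
    mexp p q = mexp p' q' ↔ p = p' ∧ q = q' := by
  refine ⟨fun h => ⟨?_, ?_⟩, fun h => by rw [h.1, h.2]⟩
  · ext y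
    have := DFunLike.congr_fun h (Sum.inl y)
    rw [mexp_apply_inl, mexp_apply_inl] at this
    split_ifs at this <;> simp_all
  · ext z
    have := DFunLike.congr_fun h (Sum.inr z)
    rw [mexp_apply_inr, mexp_apply_inr] at this
    split_ifs at this <;> simp_all

/-- Polynomials that are the sum of a linear form in `Y` and an arbitrary polynomial in `Z`. -/
def splitForms (F Y Z : Type) [Field F] : Submodule F (MvPolynomial (Y ⊕ Z) F) :=
  (homogeneousSubmodule Y F 1).map (rename Sum.inl : _ →ₐ[F] MvPolynomial (Y ⊕ Z) F).toLinearMap ⊔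
    LinearMap.range (rename Sum.inr : MvPolynomial Z F →ₐ[F] MvPolynomial (Y ⊕ Z) F).toLinearMap

theorem mem_splitForms {f : MvPolynomial (Y ⊕ Z) F} :
    f ∈ splitForms F Y Z ↔ ∃ (a : MvPolynomial Y F) (b : MvPolynomial Z F),
      a.IsHomogeneous 1 ∧ rename Sum.inl a + rename Sum.inr b = f := by
  simp only [splitForms, Submodule.mem_sup, Submodule.mem_map, LinearMap.mem_range]
  constructor
  · rintro ⟨_, ⟨a, ha, rfl⟩, _, ⟨b, rfl⟩, rfl⟩
    exact ⟨a, b, ha, rfl⟩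
  · rintro ⟨a, b, ha, rfl⟩
    exact ⟨_, ⟨a, ha, rfl⟩, _, ⟨b, rfl⟩, rfl⟩

theorem mem_splitForms_of_totalDegree_le_one {f : MvPolynomial (Y ⊕ Z) F}
    (hf : f.totalDegree ≤ 1) : f ∈ splitForms F Y Z := by
  rw [f.as_sum]
  refine Submodule.sum_mem _ fun d hd => mem_splitForms.2 ?_
  have hd1 : d.degree ≤ 1 := by
    rw [Finsupp.degree_apply]
    exact (le_totalDegree hd).trans hf
  rcases Nat.le_one_iff_eq_zero_or_eq_one.1 hd1 with h | h
  · obtain rfl := (Finsupp.degree_eq_zero_iff d).1 h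
    exact ⟨0, C (coeff 0 f), isHomogeneous_zero _ _ _, by simp⟩
  · have : d ∈ Set.range (fun a : Y ⊕ Z => Finsupp.single a 1) := by
      rw [Finsupp.range_single_one]; exact h
    obtain ⟨x | x, rfl⟩ := this
    · refine ⟨monomial (Finsupp.single x 1) (coeff (Finsupp.single (Sum.inl x) 1) f), 0,
        isHomogeneous_monomial _ (Finsupp.degree_single _ _), ?_⟩
      simp [rename_monomial]
    · refine ⟨0, monomial (Finsupp.single x 1) (coeff (Finsupp.single (Sum.inr x) 1) f),
        isHomogeneous_zero _ _ _, ?_⟩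
      simp [rename_monomial]

/-- A finite set of exponent vectors containing all those of degree at most `m`. -/
def boundedExponents (d m : ℕ) : Finset (Fin d →₀ ℕ) :=
  (Finset.finsuppAntidiag (Finset.univ : Finset (Fin (d + 1))) m).image Finsupp.tail

theorem card_boundedExponents_le (d m : ℕ) :
    (boundedExponents d m).card ≤ (m + d).choose d := by
  refine Finset.card_image_le.trans ?_
  rw [Finset.card_finsuppAntidiag_nat_eq_choose, Finset.card_univ, Fintype.card_fin,
    ← Nat.choose_symm_add]
  apply le_of_eq
  congr 1
  omega

theorem mem_boundedExponents {d m : ℕ} {α : Fin d →₀ ℕ} (h : α.degree ≤ m) :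
    α ∈ boundedExponents d m := by
  refine Finset.mem_image.2 ⟨Finsupp.cons (m - α.degree) α, ?_, Finsupp.tail_cons _ _⟩
  rw [Finset.mem_finsuppAntidiag]
  refine ⟨?_, Finset.subset_univ _⟩
  rw [Fin.sum_univ_succ]
  simp only [Finsupp.cons_zero, Finsupp.cons_succ, ← Finsupp.degree_eq_sum]
  omega

variable [Fintype Y] [Fintype Z]

theorem rank_pdMatrix_prod_le {s : ℕ} (L : Fin s → MvPolynomial (Y ⊕ Z) F)
    (hdeg : ∀ i, (L i).totalDegree ≤ 1) :
    (pdMatrix (∏ i, L i)).rank ≤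
      (Fintype.card Y + Module.finrank F (Submodule.span F (Set.range L))).choose
        (Module.finrank F (Submodule.span F (Set.range L))) := by
  set V := Submodule.span F (Set.range L) with hV
  have : Module.Finite F V := Module.Finite.span_of_finite F (Set.finite_range L)
  set d := Module.finrank F V
  let ℓ : Module.Basis (Fin d) F V := Module.finBasis F V
  have hVle : V ≤ splitForms F Y Z := by
    rw [hV, Submodule.span_le]
    rintro _ ⟨i, rfl⟩
    exact mem_splitForms_of_totalDegree_le_one (hdeg i)
  choose a b ha hab using fun t => mem_splitForms.1 (hVle (ℓ t).2)
  let c : Fin s → Fin d → F := fun i t => ℓ.repr ⟨L i, Submodule.subset_span ⟨i, rfl⟩⟩ t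
  have hc (i : Fin s) : L i = ∑ t, C (c i t) * (rename Sum.inl (a t) + rename Sum.inr (b t)) := by
    have := congrArg Subtype.val (ℓ.sum_repr ⟨L i, Submodule.subset_span ⟨i, rfl⟩⟩)
    simp only [Submodule.coe_sum, Submodule.coe_smul] at this
    rw [← this]
    simp only [hab, c, C_mul']
  let G : MvPolynomial (Fin d) (MvPolynomial Z F) :=
    ∏ i, ∑ t, C (C (c i t)) * (X t + C (b t))
  have hG : ∏ i, L i = eval₂ (rename (R := F) (Sum.inr : Z → Y ⊕ Z)).toRingHom
      (fun t => rename Sum.inl (a t)) G := by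
    simp only [G, eval₂_prod, eval₂_sum, eval₂_mul, eval₂_add, eval₂_C, eval₂_X]
    refine Finset.prod_congr rfl fun i _ => ?_
    rw [hc]
    simp
  let A : Matrix (Finset Y) (boundedExponents d (Fintype.card Y)) F := fun p α =>
    coeff (∑ y ∈ p, Finsupp.single y 1) (∏ t, a t ^ α.1 t)
  let B : Matrix (boundedExponents d (Fintype.card Y)) (Finset Z) F := fun α q =>
    coeff (∑ z ∈ q, Finsupp.single z 1) (coeff α.1 G)
  have hAB : pdMatrix (∏ i, L i) = A * B := by
    ext p q
    rw [pdMatrix, hG, eval₂_eq', coeff_sum, Matrix.mul_apply, mexp_eq_mapDomain]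
    have hterm (α : Fin d →₀ ℕ) :
        coeff ((∑ y ∈ p, Finsupp.single y 1).mapDomain Sum.inl +
          (∑ z ∈ q, Finsupp.single z 1).mapDomain Sum.inr)
          ((rename (R := F) (Sum.inr : Z → Y ⊕ Z)).toRingHom (coeff α G) *
            ∏ t, rename Sum.inl (a t) ^ α t) =
        coeff (∑ y ∈ p, Finsupp.single y 1) (∏ t, a t ^ α t) *
          coeff (∑ z ∈ q, Finsupp.single z 1) (coeff α G) := by
      rw [← coeff_rename_inl_mul_rename_inr, mul_comm]
      simp
    simp only [hterm, A, B]
    rw [Finset.sum_coe_sort (boundedExponents d (Fintype.card Y)) (fun α =>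
      coeff (∑ y ∈ p, Finsupp.single y 1) (∏ t, a t ^ α t) *
          coeff (∑ z ∈ q, Finsupp.single z 1) (coeff α G))]
    refine (Finset.sum_subset (Finset.subset_union_left
      (s₂ := boundedExponents d (Fintype.card Y))) ?_).trans
      (Finset.sum_subset Finset.subset_union_right ?_).symm
    · intro α _ hα
      rw [show coeff α G = 0 from notMem_support_iff.1 hα, coeff_zero, mul_zero]
    · intro α _ hα
      have hdegα : Fintype.card Y < α.degree := by
        by_contra! h
        exact hα (mem_boundedExponents h)
      have hhom : (∏ t, a t ^ α t).IsHomogeneous α.degree := by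
        rw [Finsupp.degree_eq_sum]
        exact IsHomogeneous.prod _ _ _ fun t _ => by simpa using (ha t).pow (α t)
      rw [hhom.coeff_eq_zero, zero_mul]
      simp only [map_sum, Finsupp.degree_single, Finset.sum_const, smul_eq_mul, mul_one]
      exact (p.card_le_univ.trans_lt hdegα).ne
  rw [hAB]
  refine (Matrix.rank_mul_le_left A B).trans (A.rank_le_card_width.trans ?_)
  rw [Fintype.card_coe]
  exact card_boundedExponents_le _ _

end PCM

namespace QPoly

open MvPolynomial PCM

theorem pdMatrix_Q {F : Type} [Field F] (n : ℕ)
    (π : Finset (Fin (n / 2)) → Finset (Fin (n / 2))) (p q : Finset (Fin (n / 2))) :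
    pdMatrix (Q F n π) p q = if p.card = n / 4 ∧ π p = q then 1 else 0 := by
  have hmon (s : Finset (Fin (n / 2))) :
      (∏ y ∈ s, (X (Sum.inl y) : MvPolynomial (Fin (n / 2) ⊕ Fin (n / 2)) F)) *
        ∏ z ∈ π s, X (Sum.inr z) = monomial (mexp s (π s)) 1 := by
    simp only [X, mexp, ← monomial_sum_one, monomial_mul, mul_one]
  simp only [pdMatrix, Q, hmon, coeff_sum, coeff_monomial, mexp_inj]
  split_ifs with h
  · rw [Finset.sum_eq_single p] <;> simp_all
  · refine Finset.sum_eq_zero fun s hs => if_neg ?_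
    rintro ⟨rfl, rfl⟩
    exact h ⟨(Finset.mem_filter.1 hs).2, rfl⟩

theorem choose_le_rank_pdMatrix_Q {F : Type} [Field F] (n : ℕ)
    (π : Finset (Fin (n / 2)) → Finset (Fin (n / 2))) (hπ : GoodPairing n π) :
    (n / 2).choose (n / 4) ≤ (pdMatrix (Q F n π)).rank := by
  let I := {s : Finset (Fin (n / 2)) // s.card = n / 4}
  have hsub : (pdMatrix (Q F n π)).submatrix (Subtype.val : I → _) (fun s : I => π s.1) = 1 := by
    ext p q
    rw [Matrix.submatrix_apply, pdMatrix_Q, Matrix.one_apply]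
    have : π p.1 = π q.1 ↔ p = q :=
      (hπ.injOn.eq_iff p.2 q.2).trans Subtype.ext_iff.symm
    simp [this, p.2]
  have hle := Matrix.rank_submatrix_le (pdMatrix (Q F n π))
    (Subtype.val : I → _) (fun s : I => π s.1)
  rw [hsub, Matrix.rank_one, Fintype.card_finset_len, Fintype.card_fin] at hle
  exact hle

end QPoly

/-- over a field of characteristic zero, if `Q` is written as a sum of
`k` products of affine forms such that the affine forms feeding each product gate span
a space of dimension at most `n/10` (product dimension at most `n/10`), then
`k · (n/2 + 1) · C(n/2 + n/10, n/10) ≥ C(n/2, n/4)`. -/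
theorem topfanin_lower_bound_Q {F : Type} [Field F] [CharZero F] (n : ℕ)
    (hn : 0 < n) (h20 : 20 ∣ n)
    (π : Finset (Fin (n / 2)) → Finset (Fin (n / 2))) (hπ : QPoly.GoodPairing n π)
    (k : ℕ) (s : Fin k → ℕ)
    (L : (j : Fin k) → Fin (s j) → MvPolynomial (Fin (n / 2) ⊕ Fin (n / 2)) F)
    (hdeg : ∀ j i, (L j i).totalDegree ≤ 1)
    (hdim : ∀ j : Fin k,
      Module.finrank F (Submodule.span F (Set.range (L j))) ≤ n / 10)
    (hrep : QPoly.Q F n π = ∑ j : Fin k, ∏ i : Fin (s j), L j i) :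
    (n / 2).choose (n / 4) ≤ k * (n / 2 + 1) * (n / 2 + n / 10).choose (n / 10) := by
  calc
    (n / 2).choose (n / 4) ≤ (PCM.pdMatrix (QPoly.Q F n π)).rank :=
      QPoly.choose_le_rank_pdMatrix_Q n π hπ
    _ ≤ ∑ j : Fin k, (PCM.pdMatrix (∏ i : Fin (s j), L j i)).rank := by
      rw [hrep, PCM.pdMatrix_sum]
      exact PCM.rank_sum_le _ _
    _ ≤ ∑ _j : Fin k, (n / 2 + n / 10).choose (n / 10) := by
      refine Finset.sum_le_sum fun j _ => (PCM.rank_pdMatrix_prod_le (L j) (hdeg j)).trans ?_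
      rw [Fintype.card_fin, ← Nat.choose_symm_add, ← Nat.choose_symm_add]
      exact Nat.choose_le_choose _ (Nat.add_le_add_left (hdim j) _)
    _ = k * (n / 2 + n / 10).choose (n / 10) := by simp
    _ ≤ k * (n / 2 + 1) * (n / 2 + n / 10).choose (n / 10) :=
      Nat.mul_le_mul_right _ (Nat.le_mul_of_pos_right _ (Nat.succ_pos _))
end
end
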